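/- For every n ≥ 3, there exists a 2-CNF propagation complete encoding of AMO_n of size 3n − 6 (using n − 3 auxiliary variables). -/

import Mathlib

/-- A literal is a variable together with a polarity (`true` = positive). -/
abbrev Lit (V : Type) := V × Bool

/-- The negation of a literal. -/
def negLit {V : Type} (l : Lit V) : Lit V := (l.1, !l.2)

/-- A clause is a finite set of literals. -/
abbrev Clause (V : Type) := Finset (Lit V)

/-- A CNF formula is a finite set of clauses. -/
abbrev CNF (V : Type) := Finset (Clause V)

/-- A clause proper contains no complementary pair of literals. -/
def IsClause {V : Type} [DecidableEq V] (C : Clause V) : Prop := ∀ l ∈ C, negLit l ∉ C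

instance {V : Type} [DecidableEq V] (C : Clause V) : Decidable (IsClause C) := by
  unfold IsClause; infer_instance

/-- A CNF formula proper consists of proper clauses. -/
def IsCNF {V : Type} [DecidableEq V] (φ : CNF V) : Prop := ∀ C ∈ φ, IsClause C

/-- Satisfaction of a literal by an assignment. -/
def LitSat {V : Type} (α : V → Bool) (l : Lit V) : Prop := α l.1 = l.2

/-- Satisfaction of a clause by an assignment. -/
def ClauseSat {V : Type} (α : V → Bool) (C : Clause V) : Prop := ∃ l ∈ C, LitSat α l

/-- Satisfaction of a CNF formula by an assignment. -/
def CnfSat {V : Type} (α : V → Bool) (φ : CNF V) : Prop := ∀ C ∈ φ, ClauseSat α C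

/-- `UnitDerives φ C` : the clause `C` can be derived from `φ` by a series of unit
resolutions (each step resolves a derived unit clause with another derived clause). -/
inductive UnitDerives {V : Type} [DecidableEq V] (φ : CNF V) : Clause V → Prop
  | base {C : Clause V} (h : C ∈ φ) : UnitDerives φ C
  | step {l : Lit V} {C : Clause V} (h1 : UnitDerives φ {l})
      (h2 : UnitDerives φ C) (h3 : negLit l ∈ C) :
      UnitDerives φ (C.erase (negLit l))

/-- The formula `φ ∧ l` (adding a unit clause). -/
def addUnit {V : Type} [DecidableEq V] (φ : CNF V) (l : Lit V) : CNF V :=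
  insert {l} φ

/-- The formula `φ ∧ g₁ ∧ … ∧ g_p` (adding finitely many unit clauses). -/
def addUnits {V : Type} [DecidableEq V] (φ : CNF V) (L : Finset (Lit V)) : CNF V :=
  φ ∪ L.image (fun l => ({l} : Clause V))

/-- Variables: `n` input variables and `ℓ` auxiliary variables. -/
abbrev Var (n ℓ : ℕ) : Type := Sum (Fin n) (Fin ℓ)

/-- The literal on the `i`-th input variable with polarity `b`. -/
def inLit {n ℓ : ℕ} (i : Fin n) (b : Bool) : Lit (Var n ℓ) := (Sum.inl i, b)

/-- A p-encoding: (P1) `φ ∧ x_i` is satisfiable for each input variable `x_i`, and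
(P2) `φ ∧ x_i ⊢₁ ¬x_j` for all `i ≠ j`. -/
def IsPEncoding {n ℓ : ℕ} (φ : CNF (Var n ℓ)) : Prop :=
  IsCNF φ ∧
  (∀ i : Fin n, ∃ α : Var n ℓ → Bool, CnfSat α φ ∧ α (Sum.inl i) = true) ∧
  (∀ i j : Fin n, i ≠ j →
    UnitDerives (addUnit φ (inLit i true)) {inLit j false})

/-- A p-encoding relative to a set `I` of input indices. -/
def IsPEncodingOn {n ℓ : ℕ} (φ : CNF (Var n ℓ)) (I : Finset (Fin n)) : Prop :=
  IsCNF φ ∧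
  (∀ i ∈ I, ∃ α : Var n ℓ → Bool, CnfSat α φ ∧ α (Sum.inl i) = true) ∧
  (∀ i ∈ I, ∀ j ∈ I, i ≠ j →
    UnitDerives (addUnit φ (inLit i true)) {inLit j false})

/-- 2-CNF: every clause has at most two literals. -/
def Is2CNF {V : Type} (φ : CNF V) : Prop := ∀ C ∈ φ, C.card ≤ 2

/-- The set of possible sizes of p-encodings with `n` input variables. -/
def pencSizes (n : ℕ) : Set ℕ :=
  {k | ∃ ℓ : ℕ, ∃ φ : CNF (Var n ℓ), IsPEncoding φ ∧ φ.card = k}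

/-- `S n` : the minimum size of a p-encoding with `n` input variables. -/
noncomputable def S (n : ℕ) : ℕ := sInf (pencSizes n)

/-- The set of possible sizes of 2-CNF p-encodings with `n` input variables. -/
def penc2Sizes (n : ℕ) : Set ℕ :=
  {k | ∃ ℓ : ℕ, ∃ φ : CNF (Var n ℓ), IsPEncoding φ ∧ Is2CNF φ ∧ φ.card = k}

/-- `S₂ n` : the minimum size of a 2-CNF p-encoding with `n` input variables. -/
noncomputable def S2 (n : ℕ) : ℕ := sInf (penc2Sizes n)

/-- `φ(x,y)` is an encoding of the boolean function `f(x)`. -/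
def Encodes {n ℓ : ℕ} (φ : CNF (Var n ℓ)) (f : (Fin n → Bool) → Prop) : Prop :=
  IsCNF φ ∧
  ∀ α : Fin n → Bool, f α ↔ ∃ β : Fin ℓ → Bool, CnfSat (Sum.elim α β) φ

/-- Injection of literals on input variables into literals of the encoding. -/
def inLits {n ℓ : ℕ} (G : Finset (Lit (Fin n))) : Finset (Lit (Var n ℓ)) :=
  G.image (fun g => ((Sum.inl g.1 : Var n ℓ), g.2))

/-- Propagation complete encoding of `f`: an encoding such that whenever
`f ∧ g₁ ∧ … ∧ g_p ⊨ h` for literals on input variables (`p ≥ 1`), unit propagation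
from `φ ∧ g₁ ∧ … ∧ g_p` derives `h` or derives the empty clause. -/
def IsPCEncoding {n ℓ : ℕ} (φ : CNF (Var n ℓ)) (f : (Fin n → Bool) → Prop) : Prop :=
  Encodes φ f ∧
  ∀ G : Finset (Lit (Fin n)), G.Nonempty → ∀ h : Lit (Fin n),
    (∀ α : Fin n → Bool, f α → (∀ g ∈ G, α g.1 = g.2) → α h.1 = h.2) →
    (UnitDerives (addUnits φ (inLits G)) {((Sum.inl h.1 : Var n ℓ), h.2)} ∨
     UnitDerives (addUnits φ (inLits G)) (∅ : Clause (Var n ℓ)))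

/-- The "at most one" function. -/
def AMO (n : ℕ) (α : Fin n → Bool) : Prop :=
  (Finset.univ.filter fun i => α i = true).card ≤ 1

/-- The "exactly one" function. -/
def EXO (n : ℕ) (α : Fin n → Bool) : Prop :=
  (Finset.univ.filter fun i => α i = true).card = 1

/-- `Qset φ i` : the set of clauses of `φ` containing the literal `¬x_i`. -/
def Qset {n ℓ : ℕ} (φ : CNF (Var n ℓ)) (i : Fin n) : CNF (Var n ℓ) :=
  φ.filter (fun C => inLit i false ∈ C)

/-- Regular form: for each `i`, `|Q_i| = 2`, clauses of `Q_i` contain no input variables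
other than `x_i`, and all clauses of `Q_i` are binary. -/
def RegularForm {n ℓ : ℕ} (φ : CNF (Var n ℓ)) : Prop :=
  ∀ i : Fin n,
    (Qset φ i).card = 2 ∧
    (∀ C ∈ Qset φ i, ∀ j : Fin n, ∀ b : Bool, ((Sum.inl j : Var n ℓ), b) ∈ C → j = i) ∧
    (∀ C ∈ Qset φ i, C.card = 2)

/-- `C` is an implicate of `φ`. -/
def Implicate {V : Type} (φ : CNF V) (C : Clause V) : Prop :=
  ∀ α : V → Bool, CnfSat α φ → ClauseSat α C

/-- `C` is a prime implicate of `φ`. -/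
def PrimeImplicate {V : Type} (φ : CNF V) (C : Clause V) : Prop :=
  Implicate φ C ∧ ∀ C' : Clause V, C' ⊂ C → ¬ Implicate φ C'

/-- `φ` is prime: every clause of `φ` is a prime implicate of `φ`. -/
def IsPrime {V : Type} (φ : CNF V) : Prop := ∀ C ∈ φ, PrimeImplicate φ C

/-- The set of clauses of `φ` in which the auxiliary variable `y` occurs
(as a positive or negative literal). -/
def occursIn {n ℓ : ℕ} (φ : CNF (Var n ℓ)) (y : Fin ℓ) : CNF (Var n ℓ) :=
  φ.filter (fun C => ((Sum.inr y : Var n ℓ), true) ∈ C ∨ ((Sum.inr y : Var n ℓ), false) ∈ C)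

/-- The substitution `g₁ ← g₂` on a literal: `g₁ ↦ g₂`, `¬g₁ ↦ ¬g₂`,
all other literals unchanged. -/
def substLit {V : Type} [DecidableEq V] (g₁ g₂ : Lit V) (l : Lit V) : Lit V :=
  if l.1 = g₁.1 then (if l.2 = g₁.2 then g₂ else negLit g₂) else l

/-- The substitution `g₁ ← g₂` applied to a clause. -/
def substClause {V : Type} [DecidableEq V] (g₁ g₂ : Lit V) (C : Clause V) : Clause V :=
  C.image (substLit g₁ g₂)

/-- The formula `φ[g₁ ← g₂]`: apply the substitution to every clause and remove the
clauses that became tautological (i.e. contain a complementary pair of literals). -/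
def substCNF {V : Type} [DecidableEq V] (g₁ g₂ : Lit V) (φ : CNF V) : CNF V :=
  (φ.image (substClause g₁ g₂)).filter (fun C => IsClause C)

/-- `restrict φ ρ` : the formula `φ(ρ)` obtained from `φ` by the partial assignment
given by the set of literals `ρ` (clauses satisfied by `ρ` are removed, and falsified
literals are removed from the remaining clauses). -/
def restrict {V : Type} [DecidableEq V] (φ : CNF V) (ρ : Finset (Lit V)) : CNF V :=
  (φ.filter (fun C => ∀ l ∈ ρ, l ∉ C)).image (fun C => C.filter (fun l => negLit l ∉ ρ))

/-- The predicate `D` is closed under unit propagation through the clause `{a, b}` in both directions. -/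
def PropagatesThrough {V : Type} (D : Lit V → Prop) (a b : Lit V) : Prop :=
  (D (negLit a) → D b) ∧ (D (negLit b) → D a)

theorem negLit_negLit {V : Type} (l : Lit V) : negLit (negLit l) = l := by
  simp [negLit]

theorem isClause_pair {V : Type} [DecidableEq V] {a b : Lit V} (h : a.1 ≠ b.1) :
    IsClause ({a, b} : Clause V) := by
  have key : ∀ l : Lit V, negLit l ≠ l := fun l hl => by
    simpa [negLit] using congrArg Prod.snd hl
  intro l hl hn
  simp only [Finset.mem_insert, Finset.mem_singleton] at hl hn
  rcases hl with rfl | rfl <;> rcases hn with hn | hn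
  · exact key _ hn
  · exact h (show (negLit l).1 = b.1 from congrArg Prod.fst hn)
  · exact h (show (negLit l).1 = a.1 from congrArg Prod.fst hn).symm
  · exact key _ hn

theorem UnitDerives.propagatesThrough {V : Type} [DecidableEq V] {φ : CNF V} {a b : Lit V}
    (hab : a.1 ≠ b.1) (h : ({a, b} : Clause V) ∈ φ) :
    PropagatesThrough (fun l => UnitDerives φ {l}) a b := by
  have hne : a ≠ b := fun e => hab (congrArg Prod.fst e)
  constructor
  · intro hd
    have := UnitDerives.step hd (.base h) (by simp [negLit_negLit])
    rwa [negLit_negLit, Finset.erase_insert (by simpa using hne)] at this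
  · intro hd
    have := UnitDerives.step hd (.base h) (by simp [negLit_negLit])
    rwa [negLit_negLit, Finset.pair_comm,
      Finset.erase_insert (by simpa using hne.symm)] at this

theorem UnitDerives.empty_of_negLit {V : Type} [DecidableEq V] {φ : CNF V} {l : Lit V}
    (h : UnitDerives φ {l}) (hn : UnitDerives φ {negLit l}) : UnitDerives φ ∅ := by
  simpa using UnitDerives.step h hn (by simp)

theorem clauseSat_pair {V : Type} [DecidableEq V] {α : V → Bool} {a b : Lit V} :
    ClauseSat α {a, b} ↔ LitSat α a ∨ LitSat α b := by
  simp [ClauseSat]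

theorem ClauseSat.propagatesThrough {V : Type} [DecidableEq V] {α : V → Bool} {a b : Lit V}
    (h : ClauseSat α {a, b}) : PropagatesThrough (LitSat α) a b := by
  rw [clauseSat_pair] at h
  have key : ∀ l : Lit V, LitSat α (negLit l) → ¬ LitSat α l := by
    intro l h₁ h₂
    simp only [LitSat, negLit] at h₁ h₂
    simp [h₂] at h₁
  exact ⟨fun ha => h.resolve_left (key a ha), fun hb => h.resolve_right (key b hb)⟩

namespace SequentialEncoding

/-- The literal implied by each of the first `k + 1` inputs: the first input for `k = 0`,
then the auxiliary variables, and finally the negated last input. -/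
def chainLit (m k : ℕ) : Lit (Var (m + 3) m) :=
  if k = 0 then inLit 0 true
  else if h : k - 1 < m then (Sum.inr ⟨k - 1, h⟩, true)
  else inLit (Fin.last _) false

/-- The negative literal on the input `k + 1`. -/
def negInput (m : ℕ) (k : Fin (m + 1)) : Lit (Var (m + 3) m) :=
  inLit ⟨k + 1, by omega⟩ false

/-- The two literals of each of the three clauses attached to position `k`. -/
def clauseLits (m : ℕ) (k : Fin (m + 1)) : Fin 3 → Lit (Var (m + 3) m) × Lit (Var (m + 3) m)
  | 0 => (negLit (chainLit m k), negInput m k)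
  | 1 => (negLit (chainLit m k), chainLit m (k + 1))
  | 2 => (negInput m k, chainLit m (k + 1))

/-- The clause with index `p`. -/
def clause (m : ℕ) (p : Fin (m + 1) × Fin 3) : Clause (Var (m + 3) m) :=
  {(clauseLits m p.1 p.2).1, (clauseLits m p.1 p.2).2}

/-- The sequential encoding of `AMO (m + 3)`. -/
def formula (m : ℕ) : CNF (Var (m + 3) m) := Finset.univ.image (clause m)

/-- Position of a variable in the order in which the encoding introduces them. -/
def rank (m : ℕ) : Var (m + 3) m → ℕ
  | Sum.inl i => if i.val = m + 2 then 2 * m + 2 else 2 * i.val - 1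
  | Sum.inr j => 2 * (j.val + 1)

theorem rank_chainLit {m k : ℕ} (hk : k ≤ m + 1) : rank m (chainLit m k).1 = 2 * k := by
  unfold chainLit
  split_ifs with h₀ h₁
  · simp [rank, inLit, h₀]
  · simp only [rank]; omega
  · simp only [rank, inLit, Fin.val_last, if_true]; omega

theorem rank_negInput {m : ℕ} (k : Fin (m + 1)) : rank m (negInput m k).1 = 2 * k + 1 := by
  have := k.isLt
  simp only [negInput, inLit, rank]
  split_ifs <;> omega

theorem clauseLits_rank (m : ℕ) (k : Fin (m + 1)) (c : Fin 3) :
    rank m (clauseLits m k c).1.1 < rank m (clauseLits m k c).2.1 ∧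
    rank m (clauseLits m k c).1.1 + rank m (clauseLits m k c).2.1 = 4 * k + 1 + c := by
  have hk := k.isLt
  have h₁ := rank_chainLit (m := m) (k := k) (by omega)
  have h₂ := rank_chainLit (m := m) (k := k + 1) (by omega)
  have h₃ := rank_negInput k
  fin_cases c <;> simp [clauseLits, negLit, h₁, h₂, h₃] <;> omega

theorem clauseLits_var_ne (m : ℕ) (k : Fin (m + 1)) (c : Fin 3) :
    (clauseLits m k c).1.1 ≠ (clauseLits m k c).2.1 := fun h => by
  have := (clauseLits_rank m k c).1
  simp [h] at this

theorem sum_rank_clause (m : ℕ) (p : Fin (m + 1) × Fin 3) :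
    ∑ l ∈ clause m p, rank m l.1 = 4 * p.1 + 1 + p.2 := by
  rw [clause, Finset.sum_pair fun h => clauseLits_var_ne m p.1 p.2 (congrArg Prod.fst h)]
  exact (clauseLits_rank m p.1 p.2).2

theorem clause_injective (m : ℕ) : Function.Injective (clause m) := by
  intro p q h
  have hp := sum_rank_clause m p
  rw [h, sum_rank_clause] at hp
  have := p.2.isLt
  have := q.2.isLt
  ext <;> omega

theorem card_formula (m : ℕ) : (formula m).card = 3 * (m + 3) - 6 := by
  rw [formula, Finset.card_image_of_injective _ (clause_injective m)]
  simp
  omega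

theorem is2CNF_formula (m : ℕ) : Is2CNF (formula m) := by
  intro C hC
  obtain ⟨p, -, rfl⟩ := Finset.mem_image.mp hC
  exact Finset.card_le_two

theorem isCNF_formula (m : ℕ) : IsCNF (formula m) := by
  intro C hC
  obtain ⟨p, -, rfl⟩ := Finset.mem_image.mp hC
  exact isClause_pair (clauseLits_var_ne m p.1 p.2)

theorem clause_mem (m : ℕ) (k : Fin (m + 1)) (c : Fin 3) :
    ({(clauseLits m k c).1, (clauseLits m k c).2} : Clause _) ∈ formula m :=
  Finset.mem_image_of_mem (clause m) (Finset.mem_univ (k, c))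

theorem inLit_false_of_true {m : ℕ} {D : Lit (Var (m + 3) m) → Prop}
    (hD : ∀ k c, PropagatesThrough D (clauseLits m k c).1 (clauseLits m k c).2)
    {i j : Fin (m + 3)} (hij : i ≠ j) (hi : D (inLit i true)) : D (inLit j false) := by
  have chain_zero : chainLit m 0 = inLit 0 true := by simp [chainLit]
  have chain_last : chainLit m (m + 1) = inLit (Fin.last _) false := by simp [chainLit]
  have input_eq (k : ℕ) (hk : k < m + 1) (b : Bool) (i : Fin (m + 3)) (hi : i.val = k + 1) :
      (inLit i b : Lit (Var (m + 3) m)) = (if b then negLit (negInput m ⟨k, hk⟩)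
        else negInput m ⟨k, hk⟩) := by
    have : i = ⟨k + 1, by omega⟩ := Fin.ext hi
    rw [this]
    cases b <;> rfl
  rcases lt_or_gt_of_ne hij with hlt | hgt
  · have hlt' : i.val < j.val := hlt
    have hj := j.isLt
    have chain_pos : ∀ k, i.val ≤ k → k ≤ m + 1 → D (chainLit m k) := by
      intro k hk
      induction k, hk using Nat.le_induction with
      | base =>
        intro hm
        rcases hv : i.val with _ | v
        · rw [chain_zero]
          rwa [show i = 0 from Fin.ext hv] at hi
        · rw [input_eq v (by omega) true i hv, if_pos rfl] at hi
          exact (hD ⟨v, by omega⟩ 2).1 hi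
      | succ k hk ih =>
        intro hm
        refine (hD ⟨k, by omega⟩ 1).1 ?_
        simpa [clauseLits, negLit_negLit] using ih (by omega)
    by_cases hjl : j.val = m + 2
    · have := chain_pos (m + 1) (by omega) le_rfl
      rwa [chain_last, ← show j = Fin.last _ from Fin.ext hjl] at this
    · obtain ⟨v, hv⟩ : ∃ v, j.val = v + 1 := ⟨j.val - 1, by omega⟩
      rw [input_eq v (by omega) false j hv, if_neg (by simp)]
      refine (hD ⟨v, by omega⟩ 0).1 ?_
      simpa [clauseLits, negLit_negLit] using chain_pos v (by omega) (by omega)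
  · have hgt' : j.val < i.val := hgt
    have hiu := i.isLt
    have chain_pred : D (negLit (chainLit m (i.val - 1))) := by
      by_cases hil : i.val = m + 2
      · rw [show i.val - 1 = m + 1 by omega, chain_last]
        rwa [show i = Fin.last _ from Fin.ext hil] at hi
      · obtain ⟨v, hv⟩ : ∃ v, i.val = v + 1 := ⟨i.val - 1, by omega⟩
        rw [input_eq v (by omega) true i hv, if_pos rfl] at hi
        have := (hD ⟨v, by omega⟩ 0).2 hi
        rwa [show i.val - 1 = v by omega]
    have chain_neg : ∀ k, k ≤ i.val - 1 → D (negLit (chainLit m k)) := by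
      intro k hk
      induction hk using Nat.decreasingInduction with
      | self => exact chain_pred
      | of_succ k hk ih => exact (hD ⟨k, by omega⟩ 1).2 ih
    rcases hv : j.val with _ | v
    · have := chain_neg 0 (by omega)
      rwa [chain_zero, ← show j = 0 from Fin.ext hv] at this
    · rw [input_eq v (by omega) false j hv, if_neg (by simp)]
      exact (hD ⟨v, by omega⟩ 2).2 (chain_neg (v + 1) (by omega))

theorem amo_iff {n : ℕ} {α : Fin n → Bool} :
    AMO n α ↔ ∀ i j, α i = true → α j = true → i = j := by
  simp [AMO, Finset.card_le_one_iff]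

theorem exists_cnfSat_of_amo {m : ℕ} {α : Fin (m + 3) → Bool} (hα : AMO (m + 3) α) :
    ∃ β : Fin m → Bool, CnfSat (Sum.elim α β) (formula m) := by
  rw [amo_iff] at hα
  refine ⟨fun j => decide (∃ i : Fin (m + 3), i.val ≤ j.val + 1 ∧ α i = true), ?_⟩
  set γ := Sum.elim α
    (fun j : Fin m => decide (∃ i : Fin (m + 3), i.val ≤ j.val + 1 ∧ α i = true)) with hγ
  have chain (k : ℕ) (hk : k ≤ m + 1) : LitSat γ (chainLit m k) ↔
      if k = m + 1 then α (Fin.last _) = false else ∃ i : Fin (m + 3), i.val ≤ k ∧ α i = true := by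
    unfold chainLit
    split_ifs with h₀ h₁ h₁ h₁ h₁
    · omega
    · subst h₀
      simp only [LitSat, inLit, hγ, Sum.elim_inl]
      refine ⟨fun h => ⟨0, by simp, h⟩, ?_⟩
      rintro ⟨i, hi, h⟩
      rwa [show i = 0 from Fin.ext (by simpa using hi)] at h
    · omega
    · simp [LitSat, hγ, show k - 1 + 1 = k by omega]
    · simp [LitSat, inLit, hγ]
    · omega
  have litSat_neg (l : Lit (Var (m + 3) m)) : LitSat γ (negLit l) ↔ ¬ LitSat γ l := by
    simp only [LitSat, negLit]
    exact Bool.eq_not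
  intro C hC
  obtain ⟨⟨k, c⟩, -, rfl⟩ := Finset.mem_image.mp hC
  have hk := k.isLt
  have input : LitSat γ (negInput m k) ↔ ¬ α ⟨k + 1, by omega⟩ = true := by
    simp [LitSat, negInput, inLit, hγ]
  have step₁ := chain k (by omega)
  rw [if_neg (by omega)] at step₁
  have chain_succ (i : Fin (m + 3)) (hi : i.val ≤ k + 1) (h : α i = true) :
      LitSat γ (chainLit m (k + 1)) := by
    rw [chain _ (by omega)]
    split_ifs with hm
    · by_contra hl
      have := congrArg Fin.val (hα i _ h (by simpa using hl))
      simp at this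
      omega
    · exact ⟨i, hi, h⟩
  rw [clause, clauseSat_pair]
  fin_cases c
  · simp only [clauseLits, litSat_neg, step₁, input]
    rw [← not_and_or]
    rintro ⟨⟨i, hi, h⟩, h'⟩
    have := congrArg Fin.val (hα _ _ h h')
    simp at this
    omega
  · simp only [clauseLits, litSat_neg, step₁]
    rw [← imp_iff_not_or]
    rintro ⟨i, hi, h⟩
    exact chain_succ i (by omega) h
  · simp only [clauseLits, input]
    rw [← imp_iff_not_or]
    exact chain_succ _ le_rfl

theorem encodes_formula (m : ℕ) : Encodes (formula m) (AMO (m + 3)) := by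
  refine ⟨isCNF_formula m, fun α => ⟨exists_cnfSat_of_amo, ?_⟩⟩
  rintro ⟨β, hβ⟩
  rw [amo_iff]
  intro i j hi hj
  by_contra hij
  have h : LitSat (Sum.elim α β) (inLit j false) :=
    inLit_false_of_true (fun k c => (hβ _ (clause_mem m k c)).propagatesThrough) hij
      (show α i = true from hi)
  have h : α j = false := h
  simp [hj] at h

theorem isPCEncoding_formula (m : ℕ) : IsPCEncoding (formula m) (AMO (m + 3)) := by
  refine ⟨encodes_formula m, fun G _ h himp => ?_⟩
  set ψ := addUnits (formula m) (inLits G) with hψ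
  have derives_of_mem (i : Fin (m + 3)) (b : Bool) (hi : (i, b) ∈ G) :
      UnitDerives ψ {inLit i b} := by
    refine .base (Finset.mem_union_right _ (Finset.mem_image_of_mem _ ?_))
    exact Finset.mem_image_of_mem
      (fun g : Lit (Fin (m + 3)) => ((Sum.inl g.1 : Var (m + 3) m), g.2)) hi
  have derives_false {i j : Fin (m + 3)} (hi : (i, true) ∈ G) (hij : i ≠ j) :
      UnitDerives ψ {inLit j false} :=
    inLit_false_of_true (D := fun l => UnitDerives ψ {l})
      (fun k c => UnitDerives.propagatesThrough (clauseLits_var_ne m k c)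
        (Finset.mem_union_left _ (clause_mem m k c))) hij (derives_of_mem i true hi)
  by_contra! hcon
  obtain ⟨hnot, hne⟩ := hcon
  have hG : h ∉ G := fun hG => hnot (derives_of_mem h.1 h.2 hG)
  have unique (i j : Fin (m + 3)) (hi : (i, true) ∈ G) (hj : (j, true) ∈ G) : i = j := by
    by_contra hij
    exact hne ((derives_of_mem j true hj).empty_of_negLit (derives_false hi hij))
  have consistent (i : Fin (m + 3)) (hi : (i, true) ∈ G) : (i, false) ∉ G := fun hf =>
    hne ((derives_of_mem i true hi).empty_of_negLit (derives_of_mem i false hf))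
  have hα := himp (fun i => decide ((i, true) ∈ G))
    (amo_iff.mpr fun i j hi hj => unique i j (by simpa using hi) (by simpa using hj))
    (by
      rintro ⟨i, _ | _⟩ hi
      · simpa using fun ht => consistent i ht hi
      · simpa using hi)
  obtain ⟨i, _ | _⟩ := h
  · have no_true (j : Fin (m + 3)) : (j, true) ∉ G := by
      intro hj
      by_cases hji : j = i
      · subst hji
        simp [hj] at hα
      · exact hnot (derives_false hj hji)
    have := himp (fun j => decide (j = i)) (amo_iff.mpr fun a b ha hb => by simp_all) (by
      rintro ⟨j, _ | _⟩ hj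
      · have : j ≠ i := by rintro rfl; exact hG hj
        simpa using this
      · exact absurd hj (no_true j))
    simp at this
  · exact hG (by simpa using hα)

end SequentialEncoding

/-- For every n ≥ 3, there exists a 2-CNF propagation complete encoding
of AMO_n of size 3n − 6 using n − 3 auxiliary variables. -/
theorem sequential_encoding_exists (n : ℕ) (hn : 3 ≤ n) :
    ∃ φ : CNF (Var n (n - 3)), IsPCEncoding φ (AMO n) ∧ Is2CNF φ ∧
      φ.card = 3 * n - 6 := by
  obtain ⟨m, rfl⟩ := Nat.exists_eq_add_of_le' hn
  exact ⟨SequentialEncoding.formula m, SequentialEncoding.isPCEncoding_formula m,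
    SequentialEncoding.is2CNF_formula m, SequentialEncoding.card_formula m⟩
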